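/- Let F be a field with an involution a↦ā, let ε₁,ε₂,ε₃ ∈ F, and let (A,B), (C,D) be pairs of n×n matrices over F. If S⁻¹(A,B)S = (C,D) for a nonsingular S, then R*·T_ε(A,B)·R = T_ε(C,D), where R := diag((S*)⁻¹,(S*)⁻¹,(S*)⁻¹,(S*)⁻¹, S, S, S, S) (an 8n×8n block-diagonal matrix with n×n blocks grouped in 4n+4n). In particular T_ε(A,B) and T_ε(C,D) are *congruent. -/

import Mathlib

open Matrix

variable {F : Type} [Field F]

/-- Conjugate transpose of a matrix with respect to an involution `σ` on `F`. -/
def starMat (σ : F →+* F) {m n : Type} (M : Matrix m n F) : Matrix n m F :=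
  (M.map σ)ᵀ

/-- The 4n×4n block matrix `J₄(0ₙ)` with `Iₙ` on the first block superdiagonal. -/
def J4 (F : Type) [Field F] (n : ℕ) : Matrix (Fin 4 × Fin n) (Fin 4 × Fin n) F :=
  fun p q => if (p.1 : ℕ) + 1 = (q.1 : ℕ) ∧ p.2 = q.2 then 1 else 0

/-- The 4n×4n block-diagonal matrix with given n×n diagonal blocks. -/
def blkDiag4 {n : ℕ} (M : Fin 4 → Matrix (Fin n) (Fin n) F) :
    Matrix (Fin 4 × Fin n) (Fin 4 × Fin n) F :=
  fun p q => if p.1 = q.1 then M p.1 p.2 q.2 else 0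

/-- `D(A,B) = diag(Iₙ, A, B, 0ₙ)`. -/
def Dmat {n : ℕ} (A B : Matrix (Fin n) (Fin n) F) :
    Matrix (Fin 4 × Fin n) (Fin 4 × Fin n) F :=
  blkDiag4 ![1, A, B, 0]

/-- The triple `T_ε(A,B)` of 8n×8n matrices. -/
def Ttriple (σ : F →+* F) (ε₁ ε₂ ε₃ : F) {n : ℕ} (A B : Matrix (Fin n) (Fin n) F) :
    Fin 3 → Matrix ((Fin 4 × Fin n) ⊕ (Fin 4 × Fin n)) ((Fin 4 × Fin n) ⊕ (Fin 4 × Fin n)) F :=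
  ![ Matrix.fromBlocks 0 1 (ε₁ • 1) 0,
     Matrix.fromBlocks 0 (J4 F n) (ε₂ • (J4 F n)ᵀ) 0,
     Matrix.fromBlocks 0 (Dmat A B) (ε₃ • Dmat (starMat σ A) (starMat σ B)) 0 ]

theorem starMat_mul (σ : F →+* F) {l m n : Type} [Fintype m] (M : Matrix l m F)
    (N : Matrix m n F) : starMat σ (M * N) = starMat σ N * starMat σ M := by
  simp [starMat, Matrix.map_mul, Matrix.transpose_mul]

theorem starMat_starMat {σ : F →+* F} (hσ : Function.Involutive σ) {m n : Type}
    (M : Matrix m n F) : starMat σ (starMat σ M) = M := by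
  ext i j
  exact hσ _

theorem starMat_one (σ : F →+* F) {m : Type} [DecidableEq m] :
    starMat σ (1 : Matrix m m F) = 1 := by
  simp [starMat]

theorem starMat_fromBlocks (σ : F →+* F) {k l m n : Type} (A : Matrix k m F)
    (B : Matrix k n F) (C : Matrix l m F) (D : Matrix l n F) :
    starMat σ (fromBlocks A B C D) =
      fromBlocks (starMat σ A) (starMat σ C) (starMat σ B) (starMat σ D) := by
  simp [starMat, fromBlocks_map, fromBlocks_transpose]

theorem blkDiag4_eq {n : ℕ} (M : Fin 4 → Matrix (Fin n) (Fin n) F) :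
    blkDiag4 M = (blockDiagonal M).submatrix Prod.swap Prod.swap := by
  ext ⟨a, i⟩ ⟨b, j⟩
  simp +contextual [blkDiag4, blockDiagonal_apply]

theorem blkDiag4_mul {n : ℕ} (M N : Fin 4 → Matrix (Fin n) (Fin n) F) :
    blkDiag4 M * blkDiag4 N = blkDiag4 (fun k => M k * N k) := by
  simp only [blkDiag4_eq, blockDiagonal_mul]
  exact submatrix_mul_equiv _ _ _ (Equiv.prodComm _ _) _

theorem blkDiag4_one {n : ℕ} :
    blkDiag4 (fun _ => (1 : Matrix (Fin n) (Fin n) F)) = 1 := by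
  ext ⟨a, i⟩ ⟨b, j⟩
  simp [blkDiag4, one_apply, ite_and]

theorem starMat_blkDiag4 (σ : F →+* F) {n : ℕ} (M : Fin 4 → Matrix (Fin n) (Fin n) F) :
    starMat σ (blkDiag4 M) = blkDiag4 (fun k => starMat σ (M k)) := by
  ext ⟨a, i⟩ ⟨b, j⟩
  by_cases h : b = a
  · subst h; simp [starMat, blkDiag4]
  · simp [starMat, blkDiag4, h, Ne.symm h]

theorem starMat_J4 (σ : F →+* F) (n : ℕ) : starMat σ (J4 F n) = (J4 F n)ᵀ := by
  ext p q
  simp only [starMat, J4, transpose_apply, map_apply]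
  split_ifs <;> simp

theorem starMat_Dmat (σ : F →+* F) {n : ℕ} (A B : Matrix (Fin n) (Fin n) F) :
    starMat σ (Dmat A B) = Dmat (starMat σ A) (starMat σ B) := by
  rw [Dmat, starMat_blkDiag4, Dmat]
  congr 1
  ext k : 1
  fin_cases k <;> simp [starMat]

theorem J4_mul_blkDiag4 {n : ℕ} (M : Matrix (Fin n) (Fin n) F) :
    J4 F n * blkDiag4 (fun _ => M) = blkDiag4 (fun _ => M) * J4 F n := by
  ext ⟨a, i⟩ ⟨b, j⟩
  simp [mul_apply, J4, blkDiag4, Fintype.sum_prod_type, ite_and]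
  rw [Finset.sum_eq_single a] <;> grind

/-- Conjugating an off-diagonal pair `(X, ε X*)` by a block-diagonal matrix acts by
`X ↦ P* X Q`. -/
theorem starMat_mul_fromBlocks_mul {σ : F →+* F} (hσ : Function.Involutive σ) {m : Type}
    [Fintype m] (ε : F) (P Q X Y : Matrix m m F) (h : starMat σ P * X * Q = Y) :
    starMat σ (fromBlocks P 0 0 Q) * fromBlocks 0 X (ε • starMat σ X) 0 * fromBlocks P 0 0 Q =
      fromBlocks 0 Y (ε • starMat σ Y) 0 := by
  have h0 : starMat σ (0 : Matrix m m F) = 0 := by simp [starMat]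
  subst h
  simp [starMat_fromBlocks, h0, fromBlocks_multiply, starMat_mul, starMat_starMat hσ,
    Matrix.mul_assoc]

/-- If S⁻¹(A,B)S = (C,D), then R* T_ε(A,B) R = T_ε(C,D) with
R = diag((S*)⁻¹,(S*)⁻¹,(S*)⁻¹,(S*)⁻¹,S,S,S,S); in particular (R being nonsingular)
T_ε(A,B) and T_ε(C,D) are *congruent. -/
theorem stmt1 (σ : F →+* F) (hσ : Function.Involutive σ)
    (ε₁ ε₂ ε₃ : F) (n : ℕ) (A B C D : Matrix (Fin n) (Fin n) F)
    (S : (Matrix (Fin n) (Fin n) F)ˣ)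
    (hAC : (↑S⁻¹ : Matrix (Fin n) (Fin n) F) * A * (↑S : Matrix (Fin n) (Fin n) F) = C)
    (hBD : (↑S⁻¹ : Matrix (Fin n) (Fin n) F) * B * (↑S : Matrix (Fin n) (Fin n) F) = D) :
    IsUnit (Matrix.fromBlocks
        (blkDiag4 (fun _ => starMat σ (↑S⁻¹ : Matrix (Fin n) (Fin n) F))) 0 0
        (blkDiag4 (fun _ => (↑S : Matrix (Fin n) (Fin n) F)))) ∧
    ∀ i, starMat σ (Matrix.fromBlocks
            (blkDiag4 (fun _ => starMat σ (↑S⁻¹ : Matrix (Fin n) (Fin n) F))) 0 0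
            (blkDiag4 (fun _ => (↑S : Matrix (Fin n) (Fin n) F)))) *
          Ttriple σ ε₁ ε₂ ε₃ A B i *
          (Matrix.fromBlocks
            (blkDiag4 (fun _ => starMat σ (↑S⁻¹ : Matrix (Fin n) (Fin n) F))) 0 0
            (blkDiag4 (fun _ => (↑S : Matrix (Fin n) (Fin n) F)))) =
          Ttriple σ ε₁ ε₂ ε₃ C D i := by
  have hP : starMat σ (blkDiag4 (fun _ : Fin 4 => starMat σ (↑S⁻¹ : Matrix (Fin n) (Fin n) F))) =
      blkDiag4 (fun _ => (↑S⁻¹ : Matrix (Fin n) (Fin n) F)) := by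
    simp only [starMat_blkDiag4, starMat_starMat hσ]
  have hS : blkDiag4 (fun _ : Fin 4 => (↑S⁻¹ : Matrix (Fin n) (Fin n) F)) *
      blkDiag4 (fun _ => (↑S : Matrix (Fin n) (Fin n) F)) = 1 := by
    rw [blkDiag4_mul, Units.inv_mul, blkDiag4_one]
  constructor
  · refine IsUnit.of_mul_eq_one (fromBlocks (blkDiag4 (fun _ => starMat σ S.val)) 0 0
      (blkDiag4 (fun _ => S⁻¹.val))) ?_
    simp [fromBlocks_multiply, blkDiag4_mul, ← starMat_mul, starMat_one, blkDiag4_one]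
  · intro i
    fin_cases i
    · have h := starMat_mul_fromBlocks_mul hσ ε₁ _ (blkDiag4 (fun _ => S.val)) 1 1
        (by rw [hP, Matrix.mul_one, hS])
      rwa [starMat_one] at h
    · have h := starMat_mul_fromBlocks_mul hσ ε₂ _ (blkDiag4 (fun _ => S.val)) (J4 F n) (J4 F n)
        (by rw [hP, Matrix.mul_assoc, J4_mul_blkDiag4, ← Matrix.mul_assoc, hS, Matrix.one_mul])
      rwa [starMat_J4] at h
    · have h := starMat_mul_fromBlocks_mul hσ ε₃ _ (blkDiag4 (fun _ => S.val))
        (Dmat A B) (Dmat C D) (by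
          rw [hP, Dmat, blkDiag4_mul, blkDiag4_mul, Dmat]
          congr 1
          ext k : 1
          fin_cases k <;> simp [← hAC, ← hBD])
      rwa [starMat_Dmat, starMat_Dmat] at h
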